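/- One has dim_ℚ [𝔭_ℚ(5,103,169)^{(59)}]_{17407} ≤ dim_{𝔽₂} [𝔭_{𝔽₂}(5,103,169)^{(59)}]_{17407}. In particular, combined with the vanishing of the right-hand side, [𝔭_K(5,103,169)^{(59)}]_{17407} = 0 for every field K of characteristic 0. -/

import Mathlib

open MvPolynomial

noncomputable section

/-- The weight function assigning degrees `a, b, c` to the variables `x, y, z`. -/
def wt (a b c : ℕ) : Fin 3 → ℕ := ![a, b, c]

/-- The `K`-algebra map `K[x,y,z] → K[T]`, `x ↦ T^a`, `y ↦ T^b`, `z ↦ T^c`. -/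
def toPoly (K : Type*) [CommRing K] (a b c : ℕ) :
    MvPolynomial (Fin 3) K →ₐ[K] Polynomial K :=
  aeval ![Polynomial.X ^ a, Polynomial.X ^ b, Polynomial.X ^ c]

/-- The space monomial prime `𝔭_K(a,b,c)`. -/
def pIdeal (K : Type*) [CommRing K] (a b c : ℕ) : Ideal (MvPolynomial (Fin 3) K) :=
  RingHom.ker (toPoly K a b c)

instance pIdeal_isPrime (K : Type*) [Field K] (a b c : ℕ) : (pIdeal K a b c).IsPrime :=
  RingHom.ker_isPrime _

/-- The `n`-th symbolic power `Q^{(n)} = Q^n A_Q ∩ A` of a prime ideal. -/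
def symbPow {A : Type*} [CommRing A] (Q : Ideal A) [Q.IsPrime] (n : ℕ) : Ideal A :=
  Ideal.comap (algebraMap A (Localization.AtPrime Q))
    (Ideal.map (algebraMap A (Localization.AtPrime Q)) (Q ^ n))

/-- The symbolic Rees algebra `A[Qt, Q^{(2)}t^2, …] ⊆ A[t]`. -/
def symbolicRees {A : Type*} [CommRing A] (Q : Ideal A) [Q.IsPrime] :
    Subalgebra A (Polynomial A) :=
  Algebra.adjoin A
    (⋃ n : ℕ, (fun p => Polynomial.C p * Polynomial.X ^ n) '' ((symbPow Q n : Ideal A) : Set A))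

/-- The degree-`d` homogeneous component `[J]_d` of an ideal `J ⊆ K[x,y,z]`,
as a `K`-subspace. -/
def gpiece (K : Type*) [CommRing K] (a b c : ℕ) (J : Ideal (MvPolynomial (Fin 3) K))
    (d : ℕ) : Submodule K (MvPolynomial (Fin 3) K) :=
  (Submodule.restrictScalars K J) ⊓ (weightedHomogeneousSubmodule K (wt a b c) d)

end

theorem mem_symbPow_iff {A : Type*} [CommRing A] {Q : Ideal A} [Q.IsPrime] {n : ℕ} {f : A} :
    f ∈ symbPow Q n ↔ ∃ g, g ∉ Q ∧ g * f ∈ Q ^ n := by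
  rw [symbPow, Ideal.mem_comap, IsLocalization.algebraMap_mem_map_algebraMap_iff Q.primeCompl]
  rfl

/-- The coefficient of `s ^ i * t ^ j` in the expansion of `f(1, 1 + s, 1 + t)`. -/
noncomputable def taylorCoeff {K : Type*} [CommRing K] (i j : ℕ) (f : MvPolynomial (Fin 3) K) : K :=
  ∑ m ∈ f.support, f.coeff m * ((m 1).choose i * (m 2).choose j : ℕ)

theorem add_pow_eq_sum_range {R : Type*} [CommRing R] (u s : R) {k N : ℕ} (h : k < N) :
    (u + s) ^ k = ∑ i ∈ Finset.range N, s ^ i * u ^ (k - i) * (k.choose i : R) := by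
  rw [add_comm u s, add_pow]
  refine Finset.sum_subset (Finset.range_mono h) fun i _ hi ↦ ?_
  rw [Nat.choose_eq_zero_of_lt (by simpa using hi)]
  simp

theorem weight_wt (a b c : ℕ) (m : Fin 3 →₀ ℕ) :
    Finsupp.weight (wt a b c) m = m 0 * a + m 1 * b + m 2 * c := by
  simp [Finsupp.weight_eq_sum, Fin.sum_univ_three, wt]

theorem monomial_map_eq_taylor {R : Type*} [CommRing R] {τ s t : R} {a b c p q r d N : ℕ}
    (hd : p * a + q * b + r * c = d) (hq : q < N) (hr : r < N) :
    (τ ^ a) ^ p * (τ ^ b + s) ^ q * (τ ^ c + t) ^ r =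
      ∑ i ∈ Finset.range N, ∑ j ∈ Finset.range N,
        ((q.choose i * r.choose j : ℕ) : R) * (τ ^ (d - b * i - c * j) * (s ^ i * t ^ j)) := by
  rw [add_pow_eq_sum_range _ s hq, add_pow_eq_sum_range _ t hr, mul_assoc, Finset.sum_mul_sum,
    Finset.mul_sum]
  refine Finset.sum_congr rfl fun i _ ↦ ?_
  rw [Finset.mul_sum]
  refine Finset.sum_congr rfl fun j _ ↦ ?_
  rcases lt_or_ge q i with hi | hi
  · simp [Nat.choose_eq_zero_of_lt hi]
  rcases lt_or_ge r j with hj | hj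
  · simp [Nat.choose_eq_zero_of_lt hj]
  obtain ⟨q', rfl⟩ := Nat.exists_eq_add_of_le hi
  obtain ⟨r', rfl⟩ := Nat.exists_eq_add_of_le hj
  have : d - b * i - c * j = a * p + b * q' + c * r' := by
    rw [← hd, Nat.sub_sub]
    refine Nat.sub_eq_of_eq_add ?_
    ring
  rw [this]
  simp only [Nat.add_sub_cancel_left, Nat.cast_mul, pow_add, pow_mul]
  ring

theorem map_eq_taylor {K R : Type*} [CommRing K] [CommRing R] [Algebra K R]
    (θ : MvPolynomial (Fin 3) K →ₐ[K] R) {a b c : ℕ} {τ s t : R} (hx : θ (X 0) = τ ^ a)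
    (hy : θ (X 1) = τ ^ b + s) (hz : θ (X 2) = τ ^ c + t) {d : ℕ} {f : MvPolynomial (Fin 3) K}
    (hf : f.IsWeightedHomogeneous (wt a b c) d) {N : ℕ}
    (hN : ∀ m ∈ f.support, m 1 < N ∧ m 2 < N) :
    θ f = ∑ i ∈ Finset.range N, ∑ j ∈ Finset.range N,
      algebraMap K R (taylorCoeff i j f) * (τ ^ (d - b * i - c * j) * (s ^ i * t ^ j)) := by
  have key : θ f = ∑ m ∈ f.support, algebraMap K R (f.coeff m) *
      ∑ i ∈ Finset.range N, ∑ j ∈ Finset.range N, (((m 1).choose i * (m 2).choose j : ℕ) : R) *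
        (τ ^ (d - b * i - c * j) * (s ^ i * t ^ j)) := by
    conv_lhs => rw [aeval_unique θ, aeval_def, eval₂_eq']
    refine Finset.sum_congr rfl fun m hm ↦ ?_
    have hd := hf (mem_support_iff.mp hm)
    rw [weight_wt] at hd
    simp only [Fin.prod_univ_three, Function.comp_apply, hx, hy, hz]
    rw [monomial_map_eq_taylor hd (hN m hm).1 (hN m hm).2]
  rw [key]
  simp only [taylorCoeff, map_sum, map_mul, map_natCast, Finset.sum_mul, Finset.mul_sum]
  rw [Finset.sum_comm]
  refine Finset.sum_congr rfl fun i _ ↦ ?_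
  rw [Finset.sum_comm]
  refine Finset.sum_congr rfl fun j _ ↦ Finset.sum_congr rfl fun m _ ↦ ?_
  ring

theorem exists_support_bound {K : Type*} [CommRing K] (f : MvPolynomial (Fin 3) K) (n : ℕ) :
    ∃ N, n ≤ N ∧ ∀ m ∈ f.support, m 1 < N ∧ m 2 < N :=
  ⟨n + f.totalDegree + 1, by omega, fun m hm ↦ by
    have h := le_totalDegree hm
    have h₁ := Finsupp.le_degree 1 m
    have h₂ := Finsupp.le_degree 2 m
    change m.degree ≤ _ at h
    omega⟩

theorem mem_idealOfVars_pow_of_mul_mem {σ R : Type*} [CommRing R] [IsDomain R] {n : ℕ}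
    {p q : MvPolynomial σ R} (hp : constantCoeff p ≠ 0) (h : p * q ∈ idealOfVars σ R ^ n) :
    q ∈ idealOfVars σ R ^ n := by
  rw [mem_pow_idealOfVars_iff'] at h ⊢
  intro x hx
  induction hk : x.degree using Nat.strong_induction_on generalizing x with
  | _ k ih =>
    classical
    have := h x hx
    rw [coeff_mul, Finset.sum_eq_single (0, x)] at this
    · exact (mul_eq_zero.mp this).resolve_left hp
    · rintro ⟨u, v⟩ huv hne
      rw [Finset.HasAntidiagonal.mem_antidiagonal] at huv
      have hu : u.degree ≠ 0 := by
        rw [Ne, Finsupp.degree_eq_zero_iff]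
        rintro rfl
        exact hne (by simpa using huv)
      have hdeg : u.degree + v.degree = x.degree := by rw [← huv, map_add]
      dsimp only
      rw [ih v.degree (by omega) v (by omega) rfl, mul_zero]
    · simp

/-- The map `x ↦ T ^ a`, `y ↦ T ^ b + s`, `z ↦ T ^ c + t`. -/
noncomputable def taylorHom (K : Type*) [CommRing K] (a b c : ℕ) :
    MvPolynomial (Fin 3) K →ₐ[K] MvPolynomial (Fin 2) (Polynomial K) :=
  aeval ![C Polynomial.X ^ a, C Polynomial.X ^ b + X 0, C Polynomial.X ^ c + X 1]

theorem constantCoeff_taylorHom {K : Type*} [CommRing K] (a b c : ℕ)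
    (f : MvPolynomial (Fin 3) K) : constantCoeff (taylorHom K a b c f) = toPoly K a b c f := by
  induction f using MvPolynomial.induction_on with
  | C r => simp [taylorHom, toPoly, algebraMap_eq, IsScalarTower.algebraMap_apply K (Polynomial K)
      (MvPolynomial (Fin 2) (Polynomial K))]
  | add p q hp hq => simp [hp, hq]
  | mul_X p i hp =>
    rw [map_mul, map_mul, map_mul, hp]
    congr 1
    fin_cases i <;> simp [taylorHom, toPoly]

theorem taylorCoeff_eq_zero_of_mem_symbPow {K : Type*} [Field K] {a b c d n : ℕ}
    {f : MvPolynomial (Fin 3) K} (hf : f.IsWeightedHomogeneous (wt a b c) d)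
    (h : f ∈ symbPow (pIdeal K a b c) n) {i j : ℕ} (hij : i + j < n) : taylorCoeff i j f = 0 := by
  obtain ⟨g, hg, hgf⟩ := mem_symbPow_iff.mp h
  set ψ := taylorHom K a b c with hψ
  have hmap : (pIdeal K a b c).map ψ ≤ idealOfVars (Fin 2) (Polynomial K) := by
    rw [Ideal.map_le_iff_le_comap]
    intro p hp
    rw [Ideal.mem_comap, ← pow_one (idealOfVars _ _), mem_pow_idealOfVars_iff']
    intro x hx
    rw [Nat.lt_one_iff, Finsupp.degree_eq_zero_iff] at hx
    subst hx
    exact (constantCoeff_taylorHom a b c p).trans hp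
  have hmem : ψ g * ψ f ∈ idealOfVars (Fin 2) (Polynomial K) ^ n := by
    rw [← map_mul]
    refine Ideal.pow_right_mono hmap n ?_
    rw [← Ideal.map_pow]
    exact Ideal.mem_map_of_mem _ hgf
  have hmem' := mem_idealOfVars_pow_of_mul_mem
    (by rw [hψ, constantCoeff_taylorHom]; exact hg) hmem
  rw [mem_pow_idealOfVars_iff'] at hmem'
  obtain ⟨N, hnN, hN⟩ := exists_support_bound f n
  have hcoeff := hmem' (Finsupp.single 0 i + Finsupp.single 1 j) (by simpa using hij)
  rw [map_eq_taylor ψ (τ := C Polynomial.X) (s := X 0) (t := X 1) (by simp [hψ, taylorHom])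
    (by simp [hψ, taylorHom]) (by simp [hψ, taylorHom]) hf hN] at hcoeff
  have hterm (k l : ℕ) : algebraMap K (MvPolynomial (Fin 2) (Polynomial K)) (taylorCoeff k l f) *
      (C Polynomial.X ^ (d - b * k - c * l) * (X 0 ^ k * X 1 ^ l)) =
      monomial (Finsupp.single 0 k + Finsupp.single 1 l)
        (Polynomial.C (taylorCoeff k l f) * Polynomial.X ^ (d - b * k - c * l)) := by
    rw [X_pow_eq_monomial, X_pow_eq_monomial, monomial_mul, ← C_pow, C_mul_monomial,
      IsScalarTower.algebraMap_apply K (Polynomial K) (MvPolynomial (Fin 2) (Polynomial K)),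
      algebraMap_eq, C_mul_monomial]
    simp
  simp only [hterm, coeff_sum] at hcoeff
  rw [Finset.sum_eq_single i, Finset.sum_eq_single j] at hcoeff
  · simpa using hcoeff
  · intro l _ hl
    rw [coeff_monomial, if_neg]
    intro h'
    exact hl (by simpa using DFunLike.congr_fun h' 1)
  · intro hj
    exact absurd (Finset.mem_range.mpr (by omega)) hj
  · intro k _ hk
    refine Finset.sum_eq_zero fun l _ ↦ ?_
    rw [coeff_monomial, if_neg]
    intro h'
    exact hk (by simpa using DFunLike.congr_fun h' 0)
  · intro hi
    exact absurd (Finset.mem_range.mpr (by omega)) hi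

theorem repr_mem_of_mem_map {A B ι : Type*} [CommRing A] [CommRing B] [Algebra A B]
    (e : Module.Basis ι A B) {I : Ideal A} {z : B} (hz : z ∈ I.map (algebraMap A B)) (i : ι) :
    e.repr z i ∈ I := by
  rw [← Submodule.restrictScalars_mem A, ← Ideal.smul_top_eq_map] at hz
  induction hz using Submodule.smul_induction_on' with
  | smul r hr m _ => simpa using I.mul_mem_right _ hr
  | add u _ v _ hu hv => simpa using I.add_mem hu hv

theorem mem_symbPow_of_mul_mem_map {A B R : Type*} [CommRing A] [CommRing B] [CommRing R]
    [Algebra A B] [Module.Free A B] {Q : Ideal A} [Q.IsPrime] {n : ℕ} {f : A} (ε : B →+* R)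
    (hε : ∀ q ∈ Q, ε (algebraMap A B q) = 0) {w : B} (hw : ε w ≠ 0)
    (h : w * algebraMap A B f ∈ (Q ^ n).map (algebraMap A B)) : f ∈ symbPow Q n := by
  let e := Module.Free.chooseBasis A B
  by_contra hf
  refine hw ?_
  have hQ (i) : e.repr w i ∈ Q := by
    by_contra hi
    refine hf (mem_symbPow_iff.mpr ⟨_, hi, ?_⟩)
    rw [mul_comm w, ← Algebra.smul_def] at h
    simpa [mul_comm] using repr_mem_of_mem_map e h i
  rw [← e.linearCombination_repr w, Finsupp.linearCombination_apply, Finsupp.sum, map_sum]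
  refine Finset.sum_eq_zero fun i _ ↦ ?_
  rw [Algebra.smul_def, map_mul, hε _ (hQ i), zero_mul]

theorem geom_sum_pow_ne_zero {K : Type*} [Field K] {a : ℕ} (ha : (a : K) ≠ 0) (b : ℕ) :
    ∑ i ∈ Finset.range a, ((Polynomial.X : Polynomial K) ^ b) ^ i *
      (Polynomial.X ^ b) ^ (a - 1 - i) ≠ 0 := by
  have h (i) (hi : i ∈ Finset.range a) : ((Polynomial.X : Polynomial K) ^ b) ^ i *
      (Polynomial.X ^ b) ^ (a - 1 - i) = (Polynomial.X ^ b) ^ (a - 1) := by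
    rw [← pow_add]
    congr 1
    have := Finset.mem_range.mp hi
    omega
  rw [Finset.sum_congr rfl h, Finset.sum_const, Finset.card_range, nsmul_eq_mul,
    ← Polynomial.C_eq_natCast]
  exact mul_ne_zero (Polynomial.C_ne_zero.mpr ha) (pow_ne_zero _ (pow_ne_zero _ Polynomial.X_ne_zero))

theorem map_mem_pow_of_taylorCoeff_eq_zero {K R : Type*} [CommRing K] [CommRing R] [Algebra K R]
    (θ : MvPolynomial (Fin 3) K →ₐ[K] R) {a b c d n : ℕ} {τ : R} (hx : θ (X 0) = τ ^ a)
    {f : MvPolynomial (Fin 3) K} (hf : f.IsWeightedHomogeneous (wt a b c) d)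
    (h : ∀ i j, i + j < n → taylorCoeff i j f = 0) :
    θ f ∈ Ideal.span {θ (X 1) - τ ^ b, θ (X 2) - τ ^ c} ^ n := by
  obtain ⟨N, -, hN⟩ := exists_support_bound f n
  rw [map_eq_taylor θ (s := θ (X 1) - τ ^ b) (t := θ (X 2) - τ ^ c) hx (by ring) (by ring) hf hN]
  refine Ideal.sum_mem _ fun i _ ↦ Ideal.sum_mem _ fun j _ ↦ ?_
  rcases lt_or_ge (i + j) n with hij | hij
  · simp [h i j hij]
  · refine Ideal.mul_mem_left _ _ (Ideal.mul_mem_left _ _ (Ideal.pow_le_pow_right hij ?_))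
    rw [pow_add]
    exact Ideal.mul_mem_mul (Ideal.pow_mem_pow (Ideal.subset_span (by simp)) _)
      (Ideal.pow_mem_pow (Ideal.subset_span (by simp)) _)

theorem mem_symbPow_of_taylorCoeff_eq_zero {K : Type*} [Field K] {a b c d n : ℕ} (ha : (a : K) ≠ 0)
    {f : MvPolynomial (Fin 3) K} (hf : f.IsWeightedHomogeneous (wt a b c) d)
    (h : ∀ i j, i + j < n → taylorCoeff i j f = 0) : f ∈ symbPow (pIdeal K a b c) n := by
  have ha' : a ≠ 0 := by rintro rfl; simp at ha
  let g : Polynomial (MvPolynomial (Fin 3) K) := Polynomial.X ^ a - Polynomial.C (X 0)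
  have hg : g.Monic := Polynomial.monic_X_pow_sub_C _ ha'
  have : Module.Free (MvPolynomial (Fin 3) K) (AdjoinRoot g) := hg.free_adjoinRoot
  let τ : AdjoinRoot g := AdjoinRoot.root g
  let θ := IsScalarTower.toAlgHom K (MvPolynomial (Fin 3) K) (AdjoinRoot g)
  have hτ : θ (X 0) = τ ^ a := by
    have : AdjoinRoot.mk g g = 0 := AdjoinRoot.mk_self
    simp only [g, map_sub, map_pow, AdjoinRoot.mk_X, AdjoinRoot.mk_C] at this
    exact (sub_eq_zero.mp this).symm
  let ε : AdjoinRoot g →+* Polynomial K :=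
    AdjoinRoot.lift (toPoly K a b c : MvPolynomial (Fin 3) K →+* Polynomial K) Polynomial.X
      (by simp [g, toPoly])
  have hεθ (p) : ε (θ p) = toPoly K a b c p := AdjoinRoot.lift_of _
  have hετ : ε τ = Polynomial.X := AdjoinRoot.lift_root _
  have hmem (v : Fin 3) (k : ℕ) (hv : toPoly K a b c (X v) = Polynomial.X ^ k) :
      (∑ i ∈ Finset.range a, θ (X v) ^ i * (τ ^ k) ^ (a - 1 - i)) * (θ (X v) - τ ^ k) ∈
        (pIdeal K a b c).map θ := by
    rw [geom_sum₂_mul, ← pow_mul, mul_comm, pow_mul, ← hτ, ← map_pow, ← map_pow, ← map_sub]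
    refine Ideal.mem_map_of_mem _ ?_
    rw [pIdeal, RingHom.mem_ker, map_sub, map_pow, map_pow, hv]
    simp [toPoly, ← pow_mul, mul_comm]
  have hy := hmem 1 b (by simp [toPoly])
  have hz := hmem 2 c (by simp [toPoly])
  set w₁ := ∑ i ∈ Finset.range a, θ (X 1) ^ i * (τ ^ b) ^ (a - 1 - i) with hw₁
  set w₂ := ∑ i ∈ Finset.range a, θ (X 2) ^ i * (τ ^ c) ^ (a - 1 - i) with hw₂
  refine mem_symbPow_of_mul_mem_map (w := (w₁ * w₂) ^ n) ε (fun q hq ↦ (hεθ q).trans hq) ?_ ?_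
  · rw [map_pow, map_mul, hw₁, hw₂]
    refine pow_ne_zero _ (mul_ne_zero ?_ ?_)
    · simpa [hεθ, hετ, toPoly] using geom_sum_pow_ne_zero ha b
    · simpa [hεθ, hετ, toPoly] using geom_sum_pow_ne_zero ha c
  · have hle : Ideal.span {w₁ * w₂} * Ideal.span {θ (X 1) - τ ^ b, θ (X 2) - τ ^ c} ≤
        (pIdeal K a b c).map θ := by
      rw [Ideal.span_singleton_mul_le_iff]
      intro z hz'
      obtain ⟨u, v, rfl⟩ := Ideal.mem_span_pair.mp hz'
      convert Ideal.add_mem _ (Ideal.mul_mem_left _ (w₂ * u) hy) (Ideal.mul_mem_left _ (w₁ * v) hz)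
        using 1
      ring
    rw [Ideal.map_pow]
    refine Ideal.pow_right_mono hle n ?_
    rw [mul_pow]
    exact Ideal.mul_mem_mul (Ideal.pow_mem_pow (Ideal.mem_span_singleton_self _) n)
      (map_mem_pow_of_taylorCoeff_eq_zero θ hτ hf h)

theorem mem_gpiece_symbPow_iff {K : Type*} [Field K] {a b c d n : ℕ} (ha : (a : K) ≠ 0)
    {f : MvPolynomial (Fin 3) K} :
    f ∈ gpiece K a b c (symbPow (pIdeal K a b c) n) d ↔
      f.IsWeightedHomogeneous (wt a b c) d ∧ ∀ i j, i + j < n → taylorCoeff i j f = 0 :=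
  ⟨fun h ↦ ⟨h.2, fun _ _ hij ↦ taylorCoeff_eq_zero_of_mem_symbPow h.2 h.1 hij⟩,
    fun h ↦ ⟨mem_symbPow_of_taylorCoeff_eq_zero ha h.1 h.2, h.1⟩⟩

/-- The rank of an integer matrix does not drop when passing from characteristic `p` to
characteristic zero. -/
theorem rank_map_intCast_zmod_le {m ι : Type*} [Fintype m] [Fintype ι] (M : Matrix m ι ℤ)
    (p : ℕ) [Fact p.Prime] (K : Type*) [Field K] [CharZero K] :
    (M.map (Int.cast : ℤ → ZMod p)).rank ≤ (M.map (Int.cast : ℤ → K)).rank := by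
  classical
  set L := (M.map (Int.cast : ℤ → ZMod p)).mulVecLin with hL
  let e : L.range ≃ₗ[ZMod p] (Fin (Module.finrank (ZMod p) L.range) → ZMod p) :=
    (Module.finBasis (ZMod p) L.range).equivFun
  obtain ⟨v, hv⟩ := L.rangeRestrict.exists_rightInverse_of_surjective L.range_rangeRestrict
  obtain ⟨u, hu⟩ := L.range.subtype.exists_leftInverse_of_injective L.range.ker_subtype
  let U := LinearMap.toMatrix' (e.toLinearMap ∘ₗ u)
  let V := LinearMap.toMatrix' (v ∘ₗ e.symm.toLinearMap)
  have hUV : U * M.map (Int.cast : ℤ → ZMod p) * V = 1 := by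
    have hM : M.map (Int.cast : ℤ → ZMod p) = LinearMap.toMatrix' L := by
      rw [hL, ← Matrix.toLin'_apply', LinearMap.toMatrix'_toLin']
    rw [hM, ← LinearMap.toMatrix'_comp, ← LinearMap.toMatrix'_comp, ← LinearMap.toMatrix'_id]
    congr 1
    refine LinearMap.ext fun x ↦ ?_
    have h₁ : L (v (e.symm x)) = L.range.subtype (e.symm x) :=
      congr_arg Subtype.val (LinearMap.congr_fun hv (e.symm x))
    have h₂ := LinearMap.congr_fun hu (e.symm x)
    simp only [LinearMap.comp_apply, LinearEquiv.coe_coe, LinearMap.id_apply] at h₂ ⊢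
    rw [h₁, h₂, e.apply_symm_apply]
  have hsurj : Function.Surjective (Int.cast : ℤ → ZMod p) := ZMod.intCast_surjective
  let s := Function.surjInv hsurj
  have hs (k) : ((s k : ℤ) : ZMod p) = k := Function.surjInv_eq hsurj k
  have hdet : (U.map s * M * V.map s).det ≠ 0 := by
    intro h
    have := congr_arg (Int.castRingHom (ZMod p)) h
    rw [RingHom.map_det, RingHom.mapMatrix_apply, Matrix.map_mul, Matrix.map_mul] at this
    have hU : (U.map s).map (Int.castRingHom (ZMod p)) = U := by ext; simp [hs]
    have hV : (V.map s).map (Int.castRingHom (ZMod p)) = V := by ext; simp [hs]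
    rw [hU, hV] at this
    have h' : U * M.map (Int.castRingHom (ZMod p)) * V = 1 := hUV
    rw [h'] at this
    simp at this
  have hunit : IsUnit ((U.map s * M * V.map s).map (Int.castRingHom K)) := by
    rw [Matrix.isUnit_iff_isUnit_det, isUnit_iff_ne_zero, ← RingHom.mapMatrix_apply,
      ← RingHom.map_det]
    simpa using hdet
  have hrank := Matrix.rank_of_isUnit _ hunit
  rw [Matrix.map_mul, Matrix.map_mul, Fintype.card_fin] at hrank
  calc (M.map (Int.cast : ℤ → ZMod p)).rank = _ := hrank.symm
    _ ≤ _ := Matrix.rank_mul_le_left _ _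
    _ ≤ _ := Matrix.rank_mul_le_right _ _

/-- The exponents of the monomials of weighted degree `d`. -/
abbrev exponents (a b c d : ℕ) : Type :=
  {m : Fin 3 →₀ ℕ // Finsupp.weight (wt a b c) m = d}

/-- The matrix of the functionals `taylorCoeff i j`, `i + j < n`, on monomials of degree `d`. -/
def taylorMatrix (a b c d n : ℕ) : Matrix (Fin n × Fin n) (exponents a b c d) ℤ := fun r m ↦
  if (r.1 : ℕ) + r.2 < n then ((m.1 1).choose r.1 * (m.1 2).choose r.2 : ℕ) else 0

/-- The polynomial with prescribed coefficients in weighted degree `d`. -/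
noncomputable def ofCoeffs (K : Type*) [CommRing K] (a b c d : ℕ) [Fintype (exponents a b c d)] :
    (exponents a b c d → K) →ₗ[K] MvPolynomial (Fin 3) K :=
  Fintype.linearCombination K fun m ↦ monomial m.1 (1 : K)

theorem coeff_ofCoeffs {K : Type*} [CommRing K] {a b c d : ℕ} [Fintype (exponents a b c d)]
    (g : exponents a b c d → K) (m : exponents a b c d) :
    coeff m.1 (ofCoeffs K a b c d g) = g m := by
  classical
  simp [ofCoeffs, Fintype.linearCombination_apply, coeff_sum, coeff_monomial, ← Subtype.ext_iff]

theorem isWeightedHomogeneous_ofCoeffs {K : Type*} [CommRing K] {a b c d : ℕ}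
    [Fintype (exponents a b c d)] (g : exponents a b c d → K) :
    (ofCoeffs K a b c d g).IsWeightedHomogeneous (wt a b c) d := by
  rw [ofCoeffs, Fintype.linearCombination_apply, ← mem_weightedHomogeneousSubmodule]
  exact Submodule.sum_mem _ fun m _ ↦
    Submodule.smul_mem _ _ (isWeightedHomogeneous_monomial _ _ _ m.2)

theorem ofCoeffs_coeff {K : Type*} [CommRing K] {a b c d : ℕ} [Fintype (exponents a b c d)]
    {f : MvPolynomial (Fin 3) K} (hf : f.IsWeightedHomogeneous (wt a b c) d) :
    ofCoeffs K a b c d (fun m ↦ coeff m.1 f) = f := by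
  ext x
  by_cases hx : Finsupp.weight (wt a b c) x = d
  · exact coeff_ofCoeffs _ ⟨x, hx⟩
  · rw [hf.coeff_eq_zero x hx, (isWeightedHomogeneous_ofCoeffs _).coeff_eq_zero x hx]

theorem ofCoeffs_injective {K : Type*} [CommRing K] {a b c d : ℕ} [Fintype (exponents a b c d)] :
    Function.Injective (ofCoeffs K a b c d) := fun g h hgh ↦ by
  ext m
  rw [← coeff_ofCoeffs g, hgh, coeff_ofCoeffs]

theorem taylorCoeff_eq_sum_exponents {K : Type*} [CommRing K] {a b c d : ℕ}
    [Fintype (exponents a b c d)] {f : MvPolynomial (Fin 3) K}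
    (hf : f.IsWeightedHomogeneous (wt a b c) d) (i j : ℕ) :
    taylorCoeff i j f =
      ∑ m : exponents a b c d, coeff m.1 f * ((m.1 1).choose i * (m.1 2).choose j : ℕ) := by
  classical
  rw [taylorCoeff]
  have himage : f.support ⊆ Finset.univ.image (Subtype.val : exponents a b c d → _) := by
    intro x hx
    simpa using hf (mem_support_iff.mp hx)
  rw [Finset.sum_subset himage fun x _ hx ↦ by rw [notMem_support_iff.mp hx, zero_mul],
    Finset.sum_image Subtype.val_injective.injOn]

theorem mulVec_taylorMatrix_eq_zero_iff {K : Type*} [CommRing K] {a b c d n : ℕ}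
    [Fintype (exponents a b c d)] (g : exponents a b c d → K) :
    ((taylorMatrix a b c d n).map (Int.cast : ℤ → K)).mulVec g = 0 ↔
      ∀ i j, i + j < n → taylorCoeff i j (ofCoeffs K a b c d g) = 0 := by
  have hrow (r : Fin n × Fin n) (hr : (r.1 : ℕ) + r.2 < n) :
      (((taylorMatrix a b c d n).map (Int.cast : ℤ → K)).mulVec g) r =
        taylorCoeff r.1 r.2 (ofCoeffs K a b c d g) := by
    rw [taylorCoeff_eq_sum_exponents (isWeightedHomogeneous_ofCoeffs g)]
    simp [Matrix.mulVec, dotProduct, taylorMatrix, hr, coeff_ofCoeffs, mul_comm]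
  constructor
  · intro h i j hij
    rw [← hrow (⟨i, by omega⟩, ⟨j, by omega⟩) hij, h, Pi.zero_apply]
  · intro h
    funext r
    by_cases hr : (r.1 : ℕ) + r.2 < n
    · rw [hrow r hr, h _ _ hr, Pi.zero_apply]
    · simp [Matrix.mulVec, dotProduct, taylorMatrix, hr]

theorem gpiece_eq_map {K : Type*} [Field K] {a b c d n : ℕ} [Fintype (exponents a b c d)]
    (ha : (a : K) ≠ 0) :
    gpiece K a b c (symbPow (pIdeal K a b c) n) d =
      (((taylorMatrix a b c d n).map (Int.cast : ℤ → K)).mulVecLin.ker).map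
        (ofCoeffs K a b c d) := by
  ext f
  simp only [mem_gpiece_symbPow_iff ha, Submodule.mem_map, LinearMap.mem_ker,
    Matrix.mulVecLin_apply, mulVec_taylorMatrix_eq_zero_iff]
  constructor
  · rintro ⟨hf, h⟩
    exact ⟨_, by rwa [ofCoeffs_coeff hf], ofCoeffs_coeff hf⟩
  · rintro ⟨g, hg, rfl⟩
    exact ⟨isWeightedHomogeneous_ofCoeffs g, hg⟩

theorem rank_add_finrank_gpiece {K : Type*} [Field K] {a b c d n : ℕ}
    [Fintype (exponents a b c d)] (ha : (a : K) ≠ 0) :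
    ((taylorMatrix a b c d n).map (Int.cast : ℤ → K)).rank +
      Module.finrank K (gpiece K a b c (symbPow (pIdeal K a b c) n) d) =
        Fintype.card (exponents a b c d) := by
  rw [gpiece_eq_map ha, ← (Submodule.equivMapOfInjective _ ofCoeffs_injective _).finrank_eq, Matrix.rank,
    LinearMap.finrank_range_add_finrank_ker, Module.finrank_fintype_fun_eq_card]

theorem finite_exponents {a b c : ℕ} (ha : a ≠ 0) (hb : b ≠ 0) (hc : c ≠ 0) (d : ℕ) :
    Finite (exponents a b c d) :=
  (Finsupp.finite_of_nat_weight_eq (wt a b c)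
    (fun i ↦ by fin_cases i <;> simpa [wt]) d).to_subtype

theorem finrank_gpiece_symbPow_le {a b c : ℕ} (hb : b ≠ 0) (hc : c ≠ 0) (d n p : ℕ)
    [Fact p.Prime] (hpa : ¬ p ∣ a) (K : Type*) [Field K] [CharZero K] :
    Module.finrank K (gpiece K a b c (symbPow (pIdeal K a b c) n) d) ≤
      Module.finrank (ZMod p)
        (gpiece (ZMod p) a b c (symbPow (pIdeal (ZMod p) a b c) n) d) := by
  have ha : a ≠ 0 := by rintro rfl; exact hpa (dvd_zero p)
  have := finite_exponents ha hb hc d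
  have := Fintype.ofFinite (exponents a b c d)
  have h₀ := rank_add_finrank_gpiece (K := K) (b := b) (c := c) (d := d) (n := n)
    (Nat.cast_ne_zero.mpr ha)
  have h₁ := rank_add_finrank_gpiece (K := ZMod p) (b := b) (c := c) (d := d) (n := n)
    (by rwa [Ne, ZMod.natCast_eq_zero_iff])
  have h₂ := rank_map_intCast_zmod_le (taylorMatrix a b c d n) p K
  omega

theorem finite_gpiece {K : Type*} [Field K] {a b c : ℕ} (ha : a ≠ 0) (hb : b ≠ 0) (hc : c ≠ 0)
    (J : Ideal (MvPolynomial (Fin 3) K)) (d : ℕ) : Module.Finite K (gpiece K a b c J d) := by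
  have : Module.Finite K (weightedHomogeneousSubmodule K (wt a b c) d) :=
    Module.Finite.iff_fg.mpr (weightedHomogeneousSubmodule_fg _ _
      (fun i ↦ by fin_cases i <;> simpa [wt]) d)
  exact Submodule.finiteDimensional_of_le (inf_le_right : gpiece K a b c J d ≤ _)

theorem finrank_gpiece_rat_le_and_eq_bot {a b c : ℕ} (hb : b ≠ 0) (hc : c ≠ 0) (d n p : ℕ)
    [Fact p.Prime] (hpa : ¬ p ∣ a) :
    Module.finrank ℚ (gpiece ℚ a b c (symbPow (pIdeal ℚ a b c) n) d) ≤
      Module.finrank (ZMod p)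
        (gpiece (ZMod p) a b c (symbPow (pIdeal (ZMod p) a b c) n) d) ∧
    (gpiece (ZMod p) a b c (symbPow (pIdeal (ZMod p) a b c) n) d = ⊥ →
      ∀ (K : Type) [Field K] [CharZero K],
        gpiece K a b c (symbPow (pIdeal K a b c) n) d = ⊥) := by
  refine ⟨finrank_gpiece_symbPow_le hb hc d n p hpa ℚ, fun h K _ _ ↦ ?_⟩
  have hK := finrank_gpiece_symbPow_le hb hc d n p hpa K
  rw [h, finrank_bot, Nat.le_zero] at hK
  have := finite_gpiece (K := K) (a := a) (by rintro rfl; exact hpa (dvd_zero p)) hb hc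
    (symbPow (pIdeal K a b c) n) d
  exact Submodule.finrank_eq_zero.mp hK

/-- `dim_ℚ [𝔭_ℚ(5,103,169)^{(59)}]_{17407} ≤
dim_{𝔽₂} [𝔭_{𝔽₂}(5,103,169)^{(59)}]_{17407}`; in particular, if the right-hand
space vanishes then `[𝔭_K(5,103,169)^{(59)}]_{17407} = 0` for every field `K`
of characteristic `0`. -/
theorem statement19 :
    Module.finrank ℚ (gpiece ℚ 5 103 169 (symbPow (pIdeal ℚ 5 103 169) 59) 17407) ≤
      Module.finrank (ZMod 2)
        (gpiece (ZMod 2) 5 103 169 (symbPow (pIdeal (ZMod 2) 5 103 169) 59) 17407) ∧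
    (gpiece (ZMod 2) 5 103 169 (symbPow (pIdeal (ZMod 2) 5 103 169) 59) 17407 = ⊥ →
      ∀ (K : Type) [Field K] [CharZero K],
        gpiece K 5 103 169 (symbPow (pIdeal K 5 103 169) 59) 17407 = ⊥) :=
  finrank_gpiece_rat_le_and_eq_bot (a := 5) (b := 103) (c := 169) (by norm_num) (by norm_num)
    17407 59 2 (by norm_num)
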